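/- arXiv:1907.05810 — 3 statements merged into one kernel-verified Lean document; each statement's English description precedes it below -/
import Mathlib

section
/- Let Y₃, Y₄, Y₅ be independent standard Gaussian random variables. Then E[ | (1/(2√2))·Y₃Y₅ + (1/8)·Y₃² − (1/8)·Y₄² | ] = √3/6. Consequently the projection coefficient k₂ := (3/π)·E[ | (1/(2√2))·Y₃Y₅ + (1/8)·Y₃² − (1/8)·Y₄² | ] equals √3/(2π). -/
open MeasureTheory ProbabilityTheory Real

/-- The law of three independent standard Gaussian random variables:
the product of three standard Gaussian measures on `ℝ`. -/
noncomputable def gauss3 : Measure (Fin 3 → ℝ) :=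
  Measure.pi fun _ => gaussianReal 0 1

lemma rad (u : ℝ) : ∫ r in Set.Ioi (0:ℝ), r * (exp (-r^2/2) * |2*u^2 - r^2|) =
    4 * exp (-u^2) - 2 + 2*u^2 := by
  set c := √2 * |u| with hc
  have hc0 : 0 ≤ c := by positivity
  have hc2 : c^2 = 2*u^2 := by rw [hc, mul_pow, sq_abs]; norm_num
  set G : ℝ → ℝ := fun r => (r^2 + 2 - c^2) * exp (-r^2/2) with hG
  have hd : ∀ r, HasDerivAt G (r * (exp (-r^2/2) * (c^2 - r^2))) r := by
    intro r
    have h1 : HasDerivAt (fun r : ℝ => r^2 + 2 - c^2) (2*r) r := by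
      simpa using ((hasDerivAt_pow 2 r).add_const 2).sub_const (c^2)
    have h2 : HasDerivAt (fun r : ℝ => exp (-r^2/2)) (exp (-r^2/2) * (-r)) r := by
      have h0 : HasDerivAt (fun r : ℝ => -r^2/2) (-r) r := by
        have := ((hasDerivAt_pow 2 r).fun_neg).div_const 2
        simp only [Nat.cast_ofNat, Nat.add_one_sub_one, pow_one] at this
        exact this.congr_deriv (by ring)
      exact h0.exp
    exact (h1.mul h2).congr_deriv (by ring)
  have ht : Filter.Tendsto G Filter.atTop (nhds 0) := by
    have e1 : Filter.Tendsto (fun r : ℝ => r^2/2) Filter.atTop Filter.atTop :=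
      (Filter.tendsto_pow_atTop (by norm_num)).atTop_div_const (by norm_num)
    have a1 := (Real.tendsto_pow_mul_exp_neg_atTop_nhds_zero 1).comp e1
    have a0 := (Real.tendsto_pow_mul_exp_neg_atTop_nhds_zero 0).comp e1
    have := (a1.const_mul 2).add (a0.const_mul (2 - c^2))
    simp only [mul_zero, add_zero] at this
    refine this.congr fun r => ?_
    simp only [hG, Function.comp, neg_div]
    ring
  have hneg : ∀ x ∈ Set.Ioi c, x * (exp (-x^2/2) * (c^2 - x^2)) ≤ 0 := by
    intro x hx
    have hx : c < x := hx
    have : c^2 - x^2 ≤ 0 := by nlinarith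
    exact mul_nonpos_of_nonneg_of_nonpos (by linarith) (mul_nonpos_of_nonneg_of_nonpos (exp_pos _).le this)
  have I2 := integral_Ioi_of_hasDerivAt_of_nonpos' (a := c) (fun x _ => hd x) hneg ht
  have J2 := integrableOn_Ioi_deriv_of_nonpos' (a := c) (fun x _ => hd x) hneg ht
  have hcont : Continuous fun x : ℝ => x * (exp (-x^2/2) * (c^2 - x^2)) := by fun_prop
  have I1 := intervalIntegral.integral_eq_sub_of_hasDerivAt (a := 0) (b := c) (fun x _ => hd x)
    (hcont.intervalIntegrable _ _)
  rw [intervalIntegral.integral_of_le hc0] at I1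
  rw [← Set.Ioc_union_Ioi_eq_Ioi hc0]
  have E1 : Set.EqOn (fun r : ℝ => r * (exp (-r^2/2) * |2*u^2 - r^2|))
      (fun x => x * (exp (-x^2/2) * (c^2 - x^2))) (Set.Ioc 0 c) := by
    intro r hr
    have : 0 ≤ c^2 - r^2 := by nlinarith [hr.1, hr.2]
    simp only [← hc2, abs_of_nonneg this]
  have E2 : Set.EqOn (fun r : ℝ => r * (exp (-r^2/2) * |2*u^2 - r^2|))
      (fun x => -(x * (exp (-x^2/2) * (c^2 - x^2)))) (Set.Ioi c) := by
    intro r hr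
    have hr : c < r := hr
    have : c^2 - r^2 ≤ 0 := by nlinarith
    simp only [← hc2, abs_of_nonpos this]; ring
  rw [setIntegral_union (Set.Ioc_disjoint_Ioi le_rfl) measurableSet_Ioi
    ((integrableOn_congr_fun E1 measurableSet_Ioc).2 (hcont.integrableOn_Ioc))
    ((integrableOn_congr_fun E2 measurableSet_Ioi).2 J2.neg),
    setIntegral_congr_fun measurableSet_Ioc E1, setIntegral_congr_fun measurableSet_Ioi E2,
    integral_neg, I1, I2]
  have : -(c^2)/2 = -u^2 := by rw [hc2]; ring
  simp only [hG, this]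
  simp [hc2]; ring

lemma inner2 (u : ℝ) : ∫ p, |2*u^2 - (p.1^2 + p.2^2)| ∂((gaussianReal 0 1).prod (gaussianReal 0 1)) =
    4 * exp (-u^2) - 2 + 2*u^2 := by
  rw [gaussianReal_of_var_ne_zero _ one_ne_zero,
    prod_withDensity (measurable_gaussianPDF _ _) (measurable_gaussianPDF _ _),
    integral_withDensity_eq_integral_toReal_smul (by fun_prop)
      (ae_of_all _ fun _ ↦ ENNReal.mul_lt_top gaussianPDF_lt_top gaussianPDF_lt_top),
    ← Measure.volume_eq_prod, ← integral_comp_polarCoord_symm, polarCoord_target]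
  have : ∀ p : ℝ × ℝ, p.1 • ((gaussianPDF 0 1 (polarCoord.symm p).1 * gaussianPDF 0 1 (polarCoord.symm p).2).toReal •
      |2 * u ^ 2 - ((polarCoord.symm p).1 ^ 2 + (polarCoord.symm p).2 ^ 2)|) =
      (p.1 * (exp (-p.1^2/2) * |2*u^2 - p.1^2|)) * (2*π)⁻¹ := by
    intro p
    have h : (p.1 * cos p.2)^2 + (p.1 * sin p.2)^2 = p.1^2 := by
      rw [mul_pow, mul_pow, ← mul_add, cos_sq_add_sin_sq, mul_one]
    simp only [polarCoord_symm_apply, h, ENNReal.toReal_mul, toReal_gaussianPDF, gaussianPDFReal, smul_eq_mul]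
    have h2 : exp (-p.1^2/2) = exp (-(p.1 * cos p.2)^2/2) * exp (-(p.1 * sin p.2)^2/2) := by
      rw [← exp_add, ← h]; ring_nf
    have h3 : (√(2*π))⁻¹ * (√(2*π))⁻¹ = (2*π)⁻¹ := by
      rw [← mul_inv, mul_self_sqrt (by positivity)]
    simp only [h2, ← h3]
    simp; ring
  simp only [this]
  rw [Measure.volume_eq_prod, setIntegral_prod_mul (fun r : ℝ => r * (exp (-r^2/2) * |2*u^2 - r^2|)) (fun _ => (2*π)⁻¹), rad]
  simp
  have : π + π ≠ 0 := by positivity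
  rw [max_eq_left (by positivity)]
  field_simp; ring

lemma outer : ∫ u, (4 * exp (-u^2) - 2 + 2*u^2) ∂(gaussianReal 0 1) = 4 / √3 := by
  have hsq : Integrable (fun u : ℝ => u^2) (gaussianReal 0 1) := by
    simpa using (memLp_id_gaussianReal (μ := 0) (v := 1) 2).integrable_sq
  have hv : ∫ u, u^2 ∂(gaussianReal 0 1) = 1 := by
    have := variance_id_gaussianReal (μ := 0) (v := 1)
    rw [variance_eq_sub (memLp_id_gaussianReal 2)] at this
    simpa using this
  have hei : Integrable (fun u : ℝ => exp (-u^2)) (gaussianReal 0 1) := by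
    refine Integrable.of_bound (by fun_prop) 1 (ae_of_all _ fun u => ?_)
    simp [abs_of_pos (exp_pos _)]; positivity
  have he : ∫ u, exp (-u^2) ∂(gaussianReal 0 1) = 1 / √3 := by
    rw [integral_gaussianReal_eq_integral_smul one_ne_zero]
    have : ∀ x : ℝ, gaussianPDFReal 0 1 x • exp (-x^2) = (√(2*π))⁻¹ * exp (-(3/2) * x^2) := by
      intro x
      simp only [gaussianPDFReal, smul_eq_mul, mul_assoc, ← exp_add]
      simp only [NNReal.coe_one, mul_one, sub_zero]
      congr 2; ring
    simp only [this]
    rw [integral_const_mul, integral_gaussian]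
    have : π / (3/2) = (2*π)/3 := by ring
    rw [this, sqrt_div (by positivity)]
    have : √(2*π) ≠ 0 := by positivity
    field_simp
  have hs : Integrable (fun u : ℝ => 4 * exp (-u^2) - 2) (gaussianReal 0 1) :=
    (hei.const_mul 4).sub (integrable_const 2)
  rw [integral_add hs (hsq.const_mul 2),
    integral_sub (hei.const_mul 4) (integrable_const 2), integral_const_mul, integral_const_mul, he, hv]
  simp; ring

lemma diag : ∫ x, |2 * (x 0)^2 - ((x 1)^2 + (x 2)^2)| ∂gauss3 = 4 / √3 := by
  have m1 := measurePreserving_piFinSuccAbove (fun _ : Fin 3 => gaussianReal 0 1) 0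
  have m2 := measurePreserving_piFinTwo (fun _ : Fin 2 => gaussianReal 0 1)
  have m3 := ((MeasurePreserving.id (gaussianReal 0 1)).prod m2).comp m1
  have hsq : Integrable (fun u : ℝ => u^2) (gaussianReal 0 1) := by
    simpa using (memLp_id_gaussianReal (μ := 0) (v := 1) 2).integrable_sq
  have key : ∫ q : ℝ × (ℝ × ℝ), |2 * q.1^2 - (q.2.1^2 + q.2.2^2)|
      ∂((gaussianReal 0 1).prod ((gaussianReal 0 1).prod (gaussianReal 0 1))) = 4 / √3 := by
    rw [integral_prod]
    · simp only [inner2, outer]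
    · refine Integrable.abs ?_
      exact ((hsq.comp_fst _).const_mul 2).sub
        (((hsq.comp_fst _).add (hsq.comp_snd _)).comp_snd (gaussianReal 0 1))
  rw [← key, ← m3.map_eq, integral_map m3.measurable.aemeasurable (by
    apply Continuous.aestronglyMeasurable; fun_prop)]
  rfl

lemma rot (f : (Fin 3 → ℝ) → ℝ) (hf : Continuous f) : ∫ y, f y ∂gauss3 =
    ∫ x, f ![(√2 * x 0 + x 2)/√3, x 1, (x 0 - √2 * x 2)/√3] ∂gauss3 := by
  let v : Fin 3 → EuclideanSpace ℝ (Fin 3) := ![!₂[√2/√3, 0, 1/√3], !₂[0,1,0], !₂[1/√3, 0, -√2/√3]]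
  have hv : Orthonormal ℝ v := by
    rw [orthonormal_iff_ite]
    intro i j
    have : √3 ≠ 0 := by positivity
    fin_cases i <;> fin_cases j <;> simp [v, PiLp.inner_apply, Fin.sum_univ_three, -inner_self_eq_norm_sq_to_K] <;> field_simp <;> norm_num
  let b := OrthonormalBasis.mk hv (hv.linearIndependent.span_eq_top_of_card_eq_finrank (by simp)).ge
  have h := (map_pi_eq_stdGaussian (ι := Fin 3)).trans (stdGaussian_eq_map_pi_orthonormalBasis b)
  have h2 : ∫ z : EuclideanSpace ℝ (Fin 3), f z.ofLp ∂(gauss3.map (WithLp.toLp 2)) = 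
    ∫ z : EuclideanSpace ℝ (Fin 3), f z.ofLp ∂(gauss3.map (fun x ↦ ∑ i, x i • b i)) := by
    unfold gauss3; rw [h]
  rw [integral_map (by fun_prop) (Continuous.aestronglyMeasurable (by fun_prop)), 
   integral_map (Continuous.aemeasurable (by fun_prop)) (Continuous.aestronglyMeasurable (by fun_prop))] at h2
  rw [h2]
  congr with x
  congr 1
  ext i
  fin_cases i <;> simp [b, v, Fin.sum_univ_three] <;> ring

theorem expectation_abs_quadratic_eq_sqrt3_div_six :
    (∫ y, |(1 / (2 * Real.sqrt 2)) * (y 0 * y 2) + (1 / 8) * (y 0) ^ 2 - (1 / 8) * (y 1) ^ 2|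
        ∂gauss3) = Real.sqrt 3 / 6 ∧
    (3 / π) *
      (∫ y, |(1 / (2 * Real.sqrt 2)) * (y 0 * y 2) + (1 / 8) * (y 0) ^ 2 - (1 / 8) * (y 1) ^ 2|
        ∂gauss3) = Real.sqrt 3 / (2 * π) := by
  have h3 : √3 ^ 2 = (3:ℝ) := by norm_num
  have h2 : √2 ^ 2 = (2:ℝ) := by norm_num
  have p3 : √3 ≠ 0 := by positivity
  have p2 : √2 ≠ 0 := by positivity
  have main : (∫ y, |(1 / (2 * Real.sqrt 2)) * (y 0 * y 2) + (1 / 8) * (y 0) ^ 2 - (1 / 8) * (y 1) ^ 2|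
        ∂gauss3) = Real.sqrt 3 / 6 := by
    rw [rot _ (by fun_prop)]
    have : ∀ x : Fin 3 → ℝ, |(1 / (2 * √2)) * ((√2 * x 0 + x 2)/√3 * ((x 0 - √2 * x 2)/√3)) +
        (1 / 8) * ((√2 * x 0 + x 2)/√3) ^ 2 - (1 / 8) * (x 1) ^ 2| =
        (1/8) * |2 * (x 0)^2 - ((x 1)^2 + (x 2)^2)| := by
      intro x
      rw [← abs_of_pos (show (0:ℝ) < 1/8 by norm_num), ← abs_mul, abs_of_pos (show (0:ℝ) < 1/8 by norm_num)]
      congr 1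
      have e : 1 / (2 * √2) = √2 / 4 := by field_simp; linarith
      rw [e, div_mul_div_comm, ← pow_two, div_pow, h3]
      linear_combination (1/12 * (x 0)^2 - 1/12 * (x 2)^2 + 1/24 * (x 0)^2 - √2/12 * x 0 * x 2) * h2
    simp only [Matrix.cons_val]
    simp only [this]
    rw [integral_const_mul, diag]
    field_simp
    linarith
  refine ⟨main, ?_⟩
  rw [main]
  field_simp
  norm_num
end

section
/- Let Y₁, Y₂, Y₃ be independent standard Gaussian random variables. Then E[ | 2√2·Y₁Y₂ + Y₁² − Y₃² | ] = 4/√3. (Equivalently, for the centred Gaussian vector (Z₁,Z₂,Z₃) = (√3·Y₁, Y₃, √(8/3)·Y₂ + Y₁/√3), whose covariance matrix is [[3,0,1],[0,1,0],[1,0,3]], one has E[ |Z₁Z₃ − Z₂²| ] = 4/√3.) -/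
open MeasureTheory ProbabilityTheory Real

noncomputable def rotVec : Fin 3 → EuclideanSpace ℝ (Fin 3) :=
  ![!₂[√2 / √3, 1 / √3, 0], !₂[1 / √3, -(√2 / √3), 0], !₂[0, 0, 1]]

lemma rotVec_orthonormal : Orthonormal ℝ rotVec := by
  have h2 : √2 ^ 2 = 2 := Real.sq_sqrt (by norm_num)
  have h3 : √3 ^ 2 = 3 := Real.sq_sqrt (by norm_num)
  have h3' : √3 ≠ 0 := by positivity
  rw [orthonormal_iff_ite]
  intro i j
  rw [PiLp.inner_apply, Fin.sum_univ_three]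
  fin_cases i <;> fin_cases j <;> simp [rotVec, div_pow, h2, h3] <;> try field_simp
  all_goals norm_num

lemma gauss3_rot (f : (Fin 3 → ℝ) → ℝ) (hf : Measurable f) :
    ∫ y, f y ∂gauss3 =
      ∫ y, f ![(√2 * y 0 + y 1) / √3, (y 0 - √2 * y 1) / √3, y 2] ∂gauss3 := by
  have hcard : Fintype.card (Fin 3) = Module.finrank ℝ (EuclideanSpace ℝ (Fin 3)) := by simp
  let b : OrthonormalBasis (Fin 3) ℝ (EuclideanSpace ℝ (Fin 3)) :=
    (basisOfOrthonormalOfCardEqFinrank rotVec_orthonormal hcard).toOrthonormalBasis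
      (by simpa using rotVec_orthonormal)
  have hb : ∀ i, b i = rotVec i := by intro i; simp [b]
  have key := (map_pi_eq_stdGaussian (ι := Fin 3)).trans
    (stdGaussian_eq_map_pi_orthonormalBasis b)
  have hg : Measurable (fun v : EuclideanSpace ℝ (Fin 3) => f (WithLp.ofLp v)) := by fun_prop
  have k2 := congrArg (fun μ => ∫ v, f (WithLp.ofLp v) ∂μ) key
  have hm : Measurable (fun x : Fin 3 → ℝ => ∑ i, x i • b i) :=
    (continuous_finsetSum _ fun i _ => (continuous_apply i).smul continuous_const).measurable
  simp only at k2
  rw [integral_map (by fun_prop) hg.aestronglyMeasurable,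
    integral_map hm.aemeasurable hg.aestronglyMeasurable] at k2
  unfold gauss3
  rw [k2]
  congr 1
  ext y
  congr 1
  ext i
  fin_cases i <;> simp [Fin.sum_univ_three, hb, rotVec] <;> ring

lemma gauss3_prod (f : ℝ × ℝ × ℝ → ℝ) :
    ∫ y, f (y 0, y 1, y 2) ∂gauss3 =
      ∫ p, f p ∂((gaussianReal 0 1).prod ((gaussianReal 0 1).prod (gaussianReal 0 1))) := by
  have m1 := measurePreserving_piFinSuccAbove (fun _ : Fin 3 => gaussianReal 0 1) 0
  have m2 := (MeasurePreserving.id (gaussianReal 0 1)).prod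
    (measurePreserving_finTwoArrow (gaussianReal 0 1))
  have e2 : MeasurableEmbedding (Prod.map (id : ℝ → ℝ) (MeasurableEquiv.finTwoArrow (α := ℝ))) :=
    ((MeasurableEquiv.refl ℝ).prodCongr MeasurableEquiv.finTwoArrow).measurableEmbedding
  rw [← m2.integral_comp e2]
  rw [← m1.integral_comp (MeasurableEquiv.measurableEmbedding _)]
  rfl

lemma gauss2_integral (f : ℝ × ℝ → ℝ) :
    ∫ p, f p ∂((gaussianReal 0 1).prod (gaussianReal 0 1)) =
      ∫ p : ℝ × ℝ, (2 * π)⁻¹ * exp (-(p.1 ^ 2 + p.2 ^ 2) / 2) * f p := by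
  rw [gaussianReal_of_var_ne_zero 0 one_ne_zero,
    prod_withDensity (measurable_gaussianPDF 0 1) (measurable_gaussianPDF 0 1),
    integral_withDensity_eq_integral_toReal_smul]
  · rw [Measure.volume_eq_prod]
    congr 1
    ext p
    have hs : √(2 * π) * √(2 * π) = 2 * π := Real.mul_self_sqrt (by positivity)
    have : (2 * π)⁻¹ = (√(2 * π))⁻¹ * (√(2 * π))⁻¹ := by rw [← mul_inv, hs]
    rw [ENNReal.toReal_mul, toReal_gaussianPDF, toReal_gaussianPDF, smul_eq_mul, this,
      gaussianPDFReal, gaussianPDFReal, neg_add, add_div, exp_add]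
    simp only [NNReal.coe_one, sub_zero, mul_one]
    ring
  · have := measurable_gaussianPDF 0 1
    fun_prop
  · exact Filter.Eventually.of_forall fun p => ENNReal.mul_lt_top gaussianPDF_lt_top gaussianPDF_lt_top

lemma radial_deriv (x r : ℝ) : HasDerivAt (fun r => -(r ^ 2 - x + 2) * exp (-r ^ 2 / 2))
    (r * ((r ^ 2 - x) * exp (-r ^ 2 / 2))) r := by
  have h := ((((hasDerivAt_pow 2 r).sub_const x).add_const 2).neg).mul
    (((hasDerivAt_pow 2 r).neg.div_const 2).exp)
  refine h.congr_deriv ?_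
  simp
  ring

lemma radial_tendsto (x : ℝ) : Filter.Tendsto (fun r : ℝ => -(r ^ 2 - x + 2) * exp (-r ^ 2 / 2))
    Filter.atTop (nhds 0) := by
  have hu : Filter.Tendsto (fun r : ℝ => r ^ 2 / 2) Filter.atTop Filter.atTop :=
    (Filter.tendsto_pow_atTop two_ne_zero).atTop_div_const (by norm_num)
  have h1 := (tendsto_pow_mul_exp_neg_atTop_nhds_zero 1).comp hu
  have h0 := (tendsto_pow_mul_exp_neg_atTop_nhds_zero 0).comp hu
  have := (h1.const_mul (-2)).add (h0.const_mul (x - 2))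
  simp only [mul_zero, add_zero] at this
  refine this.congr fun r => ?_
  simp [neg_div]
  ring

lemma radial_integral (a : ℝ) (ha : 0 ≤ a) :
    ∫ r in Set.Ioi 0, r * (exp (-r ^ 2 / 2) * max (r ^ 2 - a ^ 2) 0) = 2 * exp (-a ^ 2 / 2) := by
  have h1 : ∫ r in Set.Ioi a, r * (exp (-r ^ 2 / 2) * max (r ^ 2 - a ^ 2) 0)
      = ∫ r in Set.Ioi 0, r * (exp (-r ^ 2 / 2) * max (r ^ 2 - a ^ 2) 0) := by
    symm
    apply setIntegral_eq_of_subset_of_forall_sdiff_eq_zero measurableSet_Ioi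
      (Set.Ioi_subset_Ioi ha)
    rintro r ⟨hr, hr2⟩
    simp only [Set.mem_Ioi, not_lt] at hr hr2
    rw [max_eq_right (by nlinarith)]
    simp
  rw [← h1]
  have h2 : ∫ r in Set.Ioi a, r * (exp (-r ^ 2 / 2) * max (r ^ 2 - a ^ 2) 0)
      = ∫ r in Set.Ioi a, r * ((r ^ 2 - a ^ 2) * exp (-r ^ 2 / 2)) := by
    apply setIntegral_congr_fun measurableSet_Ioi
    intro r hr
    simp only [Set.mem_Ioi] at hr
    simp only
    rw [max_eq_left (by nlinarith)]
    ring
  rw [h2, integral_Ioi_of_hasDerivAt_of_nonneg' (fun r _ => radial_deriv (a ^ 2) r) ?_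
    (radial_tendsto (a ^ 2))]
  · ring
  · intro r hr
    simp only [Set.mem_Ioi] at hr
    have : 0 ≤ r ^ 2 - a ^ 2 := by nlinarith
    have : 0 ≤ r := by linarith
    positivity

lemma gauss2_pos_part (a : ℝ) (ha : 0 ≤ a) :
    ∫ p, max (p.1 ^ 2 + p.2 ^ 2 - a ^ 2) 0 ∂((gaussianReal 0 1).prod (gaussianReal 0 1))
      = 2 * exp (-a ^ 2 / 2) := by
  rw [gauss2_integral, ← integral_comp_polarCoord_symm]
  have : ∀ p : ℝ × ℝ, p.1 • ((2 * π)⁻¹ * exp (-((polarCoord.symm p).1 ^ 2 + (polarCoord.symm p).2 ^ 2) / 2)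
      * max ((polarCoord.symm p).1 ^ 2 + (polarCoord.symm p).2 ^ 2 - a ^ 2) 0)
      = (p.1 * (exp (-p.1 ^ 2 / 2) * max (p.1 ^ 2 - a ^ 2) 0)) * (2 * π)⁻¹ := by
    intro p
    have : (polarCoord.symm p).1 ^ 2 + (polarCoord.symm p).2 ^ 2 = p.1 ^ 2 := by
      simp only [polarCoord_symm_apply]
      linear_combination p.1 ^ 2 * Real.sin_sq_add_cos_sq p.2
    rw [this, smul_eq_mul]
    ring
  simp_rw [this]
  rw [polarCoord_target, Measure.volume_eq_prod,
    setIntegral_prod_mul (fun r : ℝ => r * (exp (-r ^ 2 / 2) * max (r ^ 2 - a ^ 2) 0))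
      (fun _ : ℝ => (2 * π)⁻¹), radial_integral a ha]
  have : 0 < π := pi_pos
  simp [this.le]
  field_simp
  ring

lemma gauss_sq_int : Integrable (fun x : ℝ => x ^ 2) (gaussianReal 0 1) :=
  (memLp_id_gaussianReal 2).integrable_sq

lemma gauss_sq : ∫ x, x ^ 2 ∂(gaussianReal 0 1) = 1 := by
  have h := variance_id_gaussianReal (μ := 0) (v := 1)
  rw [variance_eq_integral (by fun_prop)] at h
  simpa using h

lemma gauss_exp : ∫ x, exp (-x ^ 2) ∂(gaussianReal 0 1) = 1 / √3 := by
  rw [integral_gaussianReal_eq_integral_smul one_ne_zero]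
  have : ∀ x : ℝ, gaussianPDFReal 0 1 x • exp (-x ^ 2) = (√(2 * π))⁻¹ * exp (-(3 / 2) * x ^ 2) := by
    intro x
    rw [gaussianPDFReal, smul_eq_mul, mul_assoc, ← exp_add]
    simp only [NNReal.coe_one, sub_zero, mul_one]
    ring_nf
  simp_rw [this]
  rw [integral_const_mul, integral_gaussian, ← Real.sqrt_inv, ← Real.sqrt_mul (by positivity)]
  rw [one_div, ← Real.sqrt_inv]
  congr 1
  have : 0 < π := pi_pos
  field_simp

lemma gauss2_abs (a : ℝ) :
    ∫ p, |2 * a ^ 2 - (p.1 ^ 2 + p.2 ^ 2)| ∂((gaussianReal 0 1).prod (gaussianReal 0 1))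
      = 2 * a ^ 2 - 2 + 4 * exp (-a ^ 2) := by
  have i1 : Integrable (fun p : ℝ × ℝ => p.1 ^ 2) ((gaussianReal 0 1).prod (gaussianReal 0 1)) :=
    gauss_sq_int.comp_fst _
  have i2 : Integrable (fun p : ℝ × ℝ => p.2 ^ 2) ((gaussianReal 0 1).prod (gaussianReal 0 1)) :=
    gauss_sq_int.comp_snd _
  have hp := gauss2_pos_part (√2 * |a|) (by positivity)
  have ha : (√2 * |a|) ^ 2 = 2 * a ^ 2 := by
    rw [mul_pow, sq_abs, Real.sq_sqrt (by norm_num)]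
  rw [ha] at hp
  have i3 : Integrable (fun p : ℝ × ℝ => max (p.1 ^ 2 + p.2 ^ 2 - 2 * a ^ 2) 0)
      ((gaussianReal 0 1).prod (gaussianReal 0 1)) :=
    ((i1.add i2).sub (integrable_const _)).pos_part
  have e : ∀ p : ℝ × ℝ, |2 * a ^ 2 - (p.1 ^ 2 + p.2 ^ 2)| =
      (2 * a ^ 2 - (p.1 ^ 2 + p.2 ^ 2)) + 2 * max (p.1 ^ 2 + p.2 ^ 2 - 2 * a ^ 2) 0 := by
    intro p
    rcases le_total (p.1 ^ 2 + p.2 ^ 2) (2 * a ^ 2) with h | h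
    · rw [abs_of_nonneg (by linarith), max_eq_right (by linarith)]; ring
    · rw [abs_of_nonpos (by linarith), max_eq_left (by linarith)]; ring
  simp_rw [e]
  have v1 : ∫ p, p.1 ^ 2 ∂((gaussianReal 0 1).prod (gaussianReal 0 1)) = 1 := by
    rw [integral_fun_fst (fun x : ℝ => x ^ 2), gauss_sq]; simp
  have v2 : ∫ p, p.2 ^ 2 ∂((gaussianReal 0 1).prod (gaussianReal 0 1)) = 1 := by
    rw [integral_fun_snd (fun x : ℝ => x ^ 2), gauss_sq]; simp
  have i12 : Integrable (fun p : ℝ × ℝ => p.1 ^ 2 + p.2 ^ 2)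
      ((gaussianReal 0 1).prod (gaussianReal 0 1)) := i1.add i2
  have i4 : Integrable (fun p : ℝ × ℝ => 2 * a ^ 2 - (p.1 ^ 2 + p.2 ^ 2))
      ((gaussianReal 0 1).prod (gaussianReal 0 1)) := (integrable_const _).sub i12
  rw [integral_add i4 (i3.const_mul 2),
    integral_sub (integrable_const _) i12, integral_add i1 i2, integral_const, integral_const_mul, hp,
    v1, v2]
  have : -(2 * a ^ 2) / 2 = -a ^ 2 := by ring
  rw [this]
  simp
  ring

lemma diag_integral : ∫ y, |2 * (y 0) ^ 2 - ((y 1) ^ 2 + (y 2) ^ 2)| ∂gauss3 = 4 / √3 := by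
  rw [gauss3_prod (fun p => |2 * p.1 ^ 2 - (p.2.1 ^ 2 + p.2.2 ^ 2)|)]
  have i1 := gauss_sq_int.comp_fst ((gaussianReal 0 1).prod (gaussianReal 0 1))
  have i2 := (gauss_sq_int.comp_fst (gaussianReal 0 1)).comp_snd (gaussianReal 0 1)
  have i3 := (gauss_sq_int.comp_snd (gaussianReal 0 1)).comp_snd (gaussianReal 0 1)
  have i4 : Integrable (fun p : ℝ × ℝ × ℝ => |2 * p.1 ^ 2 - (p.2.1 ^ 2 + p.2.2 ^ 2)|)
      ((gaussianReal 0 1).prod ((gaussianReal 0 1).prod (gaussianReal 0 1))) :=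
    ((i1.const_mul 2).sub (i2.add i3)).abs
  rw [integral_prod _ i4]
  simp_rw [gauss2_abs]
  have ie : Integrable (fun x : ℝ => exp (-x ^ 2)) (gaussianReal 0 1) := by
    refine Integrable.of_bound (C := 1) (by fun_prop) (Filter.Eventually.of_forall fun x => ?_)
    rw [Real.norm_eq_abs, abs_of_pos (exp_pos _)]
    exact exp_le_one_iff.2 (by nlinarith [sq_nonneg x])
  have i5 : Integrable (fun x : ℝ => 2 * x ^ 2 - 2) (gaussianReal 0 1) :=
    (gauss_sq_int.const_mul 2).sub (integrable_const _)
  rw [integral_add i5 (ie.const_mul 4),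
    integral_sub (gauss_sq_int.const_mul 2) (integrable_const _), integral_const_mul,
    integral_const_mul, gauss_sq, gauss_exp]
  simp
  ring

theorem expectation_abs_Z1Z3_sub_Z2sq :
    (∫ y, |2 * Real.sqrt 2 * (y 0 * y 1) + (y 0) ^ 2 - (y 2) ^ 2| ∂gauss3)
        = 4 / Real.sqrt 3 ∧
    (∫ y, |(Real.sqrt 3 * y 0) * (Real.sqrt (8 / 3) * y 1 + y 0 / Real.sqrt 3) - (y 2) ^ 2|
        ∂gauss3) = 4 / Real.sqrt 3 := by
  have h2 : √2 ^ 2 = 2 := Real.sq_sqrt (by norm_num)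
  have h3 : √3 ^ 2 = 3 := Real.sq_sqrt (by norm_num)
  have h3' : √3 ≠ 0 := by positivity
  have first : (∫ y, |2 * Real.sqrt 2 * (y 0 * y 1) + (y 0) ^ 2 - (y 2) ^ 2| ∂gauss3)
      = 4 / Real.sqrt 3 := by
    rw [gauss3_rot (fun y => |2 * Real.sqrt 2 * (y 0 * y 1) + (y 0) ^ 2 - (y 2) ^ 2|)
      (by fun_prop), ← diag_integral]
    congr 1
    ext y
    congr 1
    simp only [Matrix.cons_val]
    field_simp
    rw [h3]
    have h4 : √2 ^ 3 = 2 * √2 := by rw [pow_succ, h2]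
    ring_nf
    simp only [h2, h4]
    ring
  refine ⟨first, ?_⟩
  rw [← first]
  congr 1
  ext y
  congr 1
  have h83 : √3 * √(8 / 3) = 2 * √2 := by
    rw [← Real.sqrt_mul (by norm_num), show (3 : ℝ) * (8 / 3) = 2 ^ 2 * 2 by norm_num,
      Real.sqrt_mul (by norm_num), Real.sqrt_sq (by norm_num)]
  have : √3 * y 0 * (√(8 / 3) * y 1 + y 0 / √3) = (√3 * √(8 / 3)) * (y 0 * y 1) + y 0 ^ 2 := by
    field_simp
  rw [this, h83]
end

section
/- Let Y₃, Y₄, Y₅ be independent standard Gaussian random variables. Then E[ | (1/(2√2))·Y₃Y₅ + (1/8)·Y₃² − (1/8)·Y₄² | · H₄(Y₅) ] = −7/(27√3). Consequently the projection coefficient k₅ := (1/π)·E[ | (1/(2√2))·Y₃Y₅ + (1/8)·Y₃² − (1/8)·Y₄² | · H₄(Y₅) ] equals −7/(27√3·π). -/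
open MeasureTheory ProbabilityTheory Real

/-- The `q`-th probabilists' Hermite polynomial, evaluated at a real number. -/
noncomputable def hermiteEval (q : ℕ) (x : ℝ) : ℝ :=
  Polynomial.aeval x (Polynomial.hermite q)

lemma aux_integrable (n : ℕ) {b : ℝ} (hb : 0 < b) :
    Integrable (fun x : ℝ => x ^ n * exp (-b * x ^ 2)) := by
  have h := integrable_rpow_mul_exp_neg_mul_sq hb (s := (n : ℝ)) (by
    have : (0:ℝ) ≤ n := Nat.cast_nonneg n
    linarith)
  simpa [rpow_natCast] using h

lemma aux_rec (n : ℕ) {b : ℝ} (hb : 0 < b) :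
    ∫ x : ℝ, x ^ (n + 2) * exp (-b * x ^ 2) =
      (n + 1) / (2 * b) * ∫ x : ℝ, x ^ n * exp (-b * x ^ 2) := by
  have hd : ∀ x : ℝ, HasDerivAt (fun x : ℝ => x ^ (n + 1) * exp (-b * x ^ 2))
      ((n + 1) * (x ^ n * exp (-b * x ^ 2)) - 2 * b * (x ^ (n + 2) * exp (-b * x ^ 2))) x := by
    intro x
    have h1 := (hasDerivAt_pow (n + 1) x).mul
      (((hasDerivAt_pow 2 x).const_mul (-b)).exp)
    refine h1.congr_deriv ?_
    push_cast
    simp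
    ring
  have hi1 := (aux_integrable n hb).const_mul ((n : ℝ) + 1)
  have hi2 := (aux_integrable (n + 2) hb).const_mul (2 * b)
  have h := integral_eq_zero_of_hasDerivAt_of_integrable hd (hi1.sub hi2) (aux_integrable (n + 1) hb)
  rw [integral_sub hi1 hi2, integral_const_mul, integral_const_mul] at h
  rw [div_mul_eq_mul_div, eq_div_iff (by positivity)]
  linarith

lemma aux_zero (b : ℝ) : ∫ x : ℝ, x ^ 0 * exp (-b * x ^ 2) = √(π / b) := by
  simpa using integral_gaussian b

lemma aux_Ioi (c d0 d1 d2 d3 : ℝ) :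
    ∫ r in Set.Ioi c, r * exp (-(1/2) * r ^ 2) * (d0 + d1 * r ^ 2 + d2 * r ^ 4 + d3 * r ^ 6) =
      exp (-(1/2) * c ^ 2) * ((d0 + 2 * d1 + 8 * d2 + 48 * d3) + (d1 + 4 * d2 + 24 * d3) * c ^ 2
        + (d2 + 6 * d3) * c ^ 4 + d3 * c ^ 6) := by
  have hd : ∀ x ∈ Set.Ici c, HasDerivAt (fun c : ℝ => - (exp (-(1/2) * c ^ 2) *
      ((d0 + 2 * d1 + 8 * d2 + 48 * d3) + (d1 + 4 * d2 + 24 * d3) * c ^ 2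
        + (d2 + 6 * d3) * c ^ 4 + d3 * c ^ 6)))
      (x * exp (-(1/2) * x ^ 2) * (d0 + d1 * x ^ 2 + d2 * x ^ 4 + d3 * x ^ 6)) x := by
    intro x _
    have h1 := ((((hasDerivAt_pow 2 x).const_mul (-(1/2 : ℝ))).exp).mul
      (((((hasDerivAt_const x (d0 + 2 * d1 + 8 * d2 + 48 * d3)).add
        ((hasDerivAt_pow 2 x).const_mul (d1 + 4 * d2 + 24 * d3))).add
        ((hasDerivAt_pow 4 x).const_mul (d2 + 6 * d3)))).add
        ((hasDerivAt_pow 6 x).const_mul d3))).neg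
    refine h1.congr_deriv ?_
    push_cast
    simp
    ring
  have hi : IntegrableOn (fun r : ℝ => r * exp (-(1/2) * r ^ 2) *
      (d0 + d1 * r ^ 2 + d2 * r ^ 4 + d3 * r ^ 6)) (Set.Ioi c) := by
    apply Integrable.integrableOn
    have h (n : ℕ) := aux_integrable n (b := 1/2) (by norm_num)
    have := ((((h 1).const_mul d0).add ((h 3).const_mul d1)).add ((h 5).const_mul d2)).add
      ((h 7).const_mul d3)
    refine this.congr (Filter.Eventually.of_forall fun r => ?_)
    simp only [Pi.add_apply]
    ring
  have ht : Filter.Tendsto (fun c : ℝ => - (exp (-(1/2) * c ^ 2) *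
      ((d0 + 2 * d1 + 8 * d2 + 48 * d3) + (d1 + 4 * d2 + 24 * d3) * c ^ 2
        + (d2 + 6 * d3) * c ^ 4 + d3 * c ^ 6))) Filter.atTop (nhds 0) := by
    have hu : Filter.Tendsto (fun c : ℝ => (1/2) * c ^ 2) Filter.atTop Filter.atTop :=
      (Filter.tendsto_pow_atTop (two_ne_zero)).const_mul_atTop (by norm_num)
    have h (n : ℕ) := (tendsto_pow_mul_exp_neg_atTop_nhds_zero n).comp hu
    have := (((((h 0).const_mul (d0 + 2 * d1 + 8 * d2 + 48 * d3)).add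
      ((h 1).const_mul (2 * (d1 + 4 * d2 + 24 * d3)))).add
      ((h 2).const_mul (4 * (d2 + 6 * d3)))).add ((h 3).const_mul (8 * d3))).neg
    simp only [mul_zero, add_zero, neg_zero] at this
    convert this using 1
    ext r
    simp
    ring_nf
  have := integral_Ioi_of_hasDerivAt_of_tendsto' hd hi ht
  rw [this]
  ring

lemma aux_radial (a c0 c1 c2 : ℝ) :
    ∫ r in Set.Ioi (0:ℝ), r * exp (-(1/2) * r ^ 2) * (|2 * a ^ 2 - r ^ 2| *
        (c0 + c1 * r ^ 2 + c2 * r ^ 4)) =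
      2 * a ^ 2 * (c0 + 2 * c1 + 8 * c2) - (2 * c0 + 8 * c1 + 48 * c2)
      + 2 * exp (-a ^ 2) * (2 * c0 + c1 * (8 + 4 * a ^ 2) + c2 * (48 + 32 * a ^ 2 + 8 * a ^ 4)) := by
  set t := √2 * |a| with ht
  have ht0 : 0 ≤ t := by positivity
  have ht2 : t ^ 2 = 2 * a ^ 2 := by rw [ht, mul_pow, sq_sqrt (by norm_num), sq_abs]
  have hI (c d0 d1 d2 d3 : ℝ) : IntegrableOn (fun r : ℝ => r * exp (-(1/2) * r ^ 2) *
      (d0 + d1 * r ^ 2 + d2 * r ^ 4 + d3 * r ^ 6)) (Set.Ioi c) := by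
    apply Integrable.integrableOn
    have h (n : ℕ) := aux_integrable n (b := 1/2) (by norm_num)
    have := ((((h 1).const_mul d0).add ((h 3).const_mul d1)).add ((h 5).const_mul d2)).add
      ((h 7).const_mul d3)
    refine this.congr (Filter.Eventually.of_forall fun r => ?_)
    simp only [Pi.add_apply]
    ring
  have e1 : ∀ r ∈ Set.Ioi (0:ℝ), r * exp (-(1/2) * r ^ 2) * (|2 * a ^ 2 - r ^ 2| *
        (c0 + c1 * r ^ 2 + c2 * r ^ 4)) =
      r * exp (-(1/2) * r ^ 2) * (2 * a ^ 2 * c0 + (2 * a ^ 2 * c1 - c0) * r ^ 2 +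
        (2 * a ^ 2 * c2 - c1) * r ^ 4 + (-c2) * r ^ 6) +
      2 * (Set.Ioi t).indicator (fun r => r * exp (-(1/2) * r ^ 2) * (-(2 * a ^ 2 * c0) +
        (-(2 * a ^ 2 * c1 - c0)) * r ^ 2 +
        (-(2 * a ^ 2 * c2 - c1)) * r ^ 4 + c2 * r ^ 6)) r := by
    intro r hr
    simp only [Set.mem_Ioi] at hr
    by_cases h : t < r
    · rw [Set.indicator_of_mem (by exact h)]
      have : 2 * a ^ 2 - r ^ 2 ≤ 0 := by rw [← ht2]; nlinarith
      rw [abs_of_nonpos this]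
      ring
    · rw [Set.indicator_of_notMem (by exact h)]
      have : 0 ≤ 2 * a ^ 2 - r ^ 2 := by rw [← ht2]; nlinarith
      rw [abs_of_nonneg this]
      ring
  rw [setIntegral_congr_fun measurableSet_Ioi e1, integral_add (hI _ _ _ _ _)
    ((((hI _ _ _ _ _).integrable_indicator measurableSet_Ioi).integrableOn).const_mul 2),
    integral_const_mul, aux_Ioi, integral_indicator measurableSet_Ioi,
    Measure.restrict_restrict measurableSet_Ioi, Set.inter_eq_left.2 (Set.Ioi_subset_Ioi ht0),
    aux_Ioi]
  have h4 : t ^ 4 = (2 * a ^ 2) ^ 2 := by rw [← ht2]; ring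
  have h6 : t ^ 6 = (2 * a ^ 2) ^ 3 := by rw [← ht2]; ring
  rw [h4, h6, ht2]
  have : -(1 / 2) * (2 * a ^ 2) = -a ^ 2 := by ring
  rw [this]
  simp
  ring

lemma aux_prod (f : ℝ × ℝ → ℝ) :
    ∫ p, f p ∂((gaussianReal 0 1).prod (gaussianReal 0 1)) =
      ∫ p : ℝ × ℝ, (2 * π)⁻¹ * exp (-(1/2) * (p.1 ^ 2 + p.2 ^ 2)) * f p := by
  rw [gaussianReal_of_var_ne_zero 0 one_ne_zero,
    prod_withDensity (measurable_gaussianPDF 0 1) (measurable_gaussianPDF 0 1),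
    integral_withDensity_eq_integral_toReal_smul]
  · refine integral_congr_ae (Filter.Eventually.of_forall fun p => ?_)
    simp only [ENNReal.toReal_mul, toReal_gaussianPDF, gaussianPDFReal, smul_eq_mul]
    have h : √(2 * π) * √(2 * π) = 2 * π := mul_self_sqrt (by positivity)
    have : -(1/2) * (p.1 ^ 2 + p.2 ^ 2) = -(p.1 - 0) ^ 2 / (2 * 1) + -(p.2 - 0) ^ 2 / (2 * 1) := by
      ring
    have h_inv : (2 * π)⁻¹ = (√(2 * π))⁻¹ * (√(2 * π))⁻¹ := by rw [← mul_inv, h]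
    rw [this, exp_add, h_inv]
    simp only [NNReal.coe_one, mul_one]
    ring
  · exact ((measurable_gaussianPDF 0 1).comp measurable_fst).mul
      ((measurable_gaussianPDF 0 1).comp measurable_snd)
  · exact Filter.Eventually.of_forall fun p => ENNReal.mul_lt_top gaussianPDF_lt_top gaussianPDF_lt_top

lemma aux_cos (k : ℕ) (x : ℝ) (h : ∫ θ in (-π)..π, cos θ ^ k = x) :
    ∫ θ in Set.Ioo (-π) π, cos θ ^ k = x := by
  rw [← integral_Ioc_eq_integral_Ioo, ← intervalIntegral.integral_of_le (by linarith [pi_pos]), h]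

lemma aux_polar (f : ℝ → ℝ) (D : ℕ → ℝ)
    (hf : ∀ k : ℕ, IntegrableOn (fun r => f r * r ^ k) (Set.Ioi 0)) :
    ∫ p in polarCoord.target, f p.1 * (D 0 + D 1 * (p.1 * cos p.2) + D 2 * (p.1 * cos p.2) ^ 2
      + D 3 * (p.1 * cos p.2) ^ 3 + D 4 * (p.1 * cos p.2) ^ 4) =
    ∫ r in Set.Ioi (0:ℝ), 2 * π * (f r * (D 0 + D 2 / 2 * r ^ 2 + 3 / 8 * D 4 * r ^ 4)) := by
  have hcos : ∀ k : ℕ, IntegrableOn (fun θ => cos θ ^ k) (Set.Ioo (-π) π) := fun k =>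
    ((by fun_prop : Continuous fun θ : ℝ => cos θ ^ k).integrableOn_Icc).mono_set
      Set.Ioo_subset_Icc_self
  have hI : ∀ k : ℕ, IntegrableOn (fun p : ℝ × ℝ => D k * ((f p.1 * p.1 ^ k) * cos p.2 ^ k))
      (Set.Ioi 0 ×ˢ Set.Ioo (-π) π) := by
    intro k
    rw [IntegrableOn, Measure.volume_eq_prod, ← Measure.prod_restrict]
    exact (Integrable.mul_prod (hf k) (hcos k)).const_mul _
  have hv : ∀ k : ℕ, ∫ p in (Set.Ioi (0:ℝ) ×ˢ Set.Ioo (-π) π), D k * ((f p.1 * p.1 ^ k) * cos p.2 ^ k)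
      = D k * ((∫ r in Set.Ioi (0:ℝ), f r * r ^ k) * ∫ θ in Set.Ioo (-π) π, cos θ ^ k) := by
    intro k
    rw [integral_const_mul, Measure.volume_eq_prod,
      setIntegral_prod_mul (fun r => f r * r ^ k) (fun θ => cos θ ^ k)]
  have c0 : ∫ θ in Set.Ioo (-π) π, cos θ ^ 0 = 2 * π := aux_cos _ _ (by simp; ring)
  have c1 : ∫ θ in Set.Ioo (-π) π, cos θ ^ 1 = 0 := aux_cos _ _ (by simp)
  have i2 : ∫ θ in (-π)..π, cos θ ^ 2 = π := by rw [integral_cos_sq]; simp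
  have c2 : ∫ θ in Set.Ioo (-π) π, cos θ ^ 2 = π := aux_cos _ _ i2
  have c3 : ∫ θ in Set.Ioo (-π) π, cos θ ^ 3 = 0 := aux_cos _ _ (by rw [integral_cos_pow_three]; simp)
  have c4 : ∫ θ in Set.Ioo (-π) π, cos θ ^ 4 = 3 / 4 * π :=
    aux_cos _ _ (by rw [integral_cos_pow (n := 2), i2]; simp; norm_num)
  have e : ∀ p : ℝ × ℝ, f p.1 * (D 0 + D 1 * (p.1 * cos p.2) + D 2 * (p.1 * cos p.2) ^ 2
      + D 3 * (p.1 * cos p.2) ^ 3 + D 4 * (p.1 * cos p.2) ^ 4) =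
      ∑ k ∈ Finset.range 5, D k * ((f p.1 * p.1 ^ k) * cos p.2 ^ k) := by
    intro p
    simp only [Finset.sum_range_succ, Finset.sum_range_zero]
    ring
  have e_two : ∀ r : ℝ, 2 * π * (f r * (D 0 + D 2 / 2 * r ^ 2 + 3 / 8 * D 4 * r ^ 4)) =
      2 * π * D 0 * (f r * r ^ 0) + π * D 2 * (f r * r ^ 2) + 3 / 4 * π * D 4 * (f r * r ^ 4) := by
    intro r
    ring
  simp_rw [e, e_two]
  rw [polarCoord_target, integral_finsetSum _ (fun k _ => hI k)]
  simp_rw [hv]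
  rw [integral_add (((hf 0).const_mul _).fun_add ((hf 2).const_mul _)) ((hf 4).const_mul _),
    integral_add ((hf 0).const_mul _) ((hf 2).const_mul _)]
  simp only [integral_const_mul, Finset.sum_range_succ, Finset.sum_range_zero, c0, c1, c2, c3, c4]
  ring

lemma aux_inner (a c s : ℝ) (hc : c ^ 2 = 1 / 3) (hs : s ^ 2 = 2 / 3) :
    ∫ p : ℝ × ℝ, |2 * a ^ 2 - p.1 ^ 2 - p.2 ^ 2| *
      ((c * a - s * p.1) ^ 4 - 6 * (c * a - s * p.1) ^ 2 + 3)
      ∂((gaussianReal 0 1).prod (gaussianReal 0 1)) =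
    2 * a ^ 2 * ((a ^ 4 / 9 - 2 * a ^ 2 + 3) + 2 * (2 / 3 * a ^ 2 - 2) + 8 * (1 / 6))
      - (2 * (a ^ 4 / 9 - 2 * a ^ 2 + 3) + 8 * (2 / 3 * a ^ 2 - 2) + 48 * (1 / 6))
      + 2 * exp (-a ^ 2) * (2 * (a ^ 4 / 9 - 2 * a ^ 2 + 3)
        + (2 / 3 * a ^ 2 - 2) * (8 + 4 * a ^ 2) + (1 / 6) * (48 + 32 * a ^ 2 + 8 * a ^ 4)) := by
  rw [← aux_radial, aux_prod, ← integral_comp_polarCoord_symm]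
  have hc4 : c ^ 4 = 1 / 9 := by rw [show c ^ 4 = (c ^ 2) ^ 2 by ring, hc]; norm_num
  have hs4 : s ^ 4 = 4 / 9 := by rw [show s ^ 4 = (s ^ 2) ^ 2 by ring, hs]; norm_num
  set D : ℕ → ℝ := fun k => match k with
    | 0 => a ^ 4 / 9 - 2 * a ^ 2 + 3
    | 1 => -4 * c ^ 3 * s * a ^ 3 + 12 * c * s * a
    | 2 => 4 / 3 * a ^ 2 - 4
    | 3 => -4 * c * s ^ 3 * a
    | _ => 4 / 9 with hD
  set f : ℝ → ℝ := fun r => (2 * π)⁻¹ * (r * exp (-(1/2) * r ^ 2) * |2 * a ^ 2 - r ^ 2|) with hf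
  have key := aux_polar f D (by
    intro k
    apply Integrable.integrableOn
    have h (n : ℕ) := aux_integrable n (b := 1/2) (by norm_num)
    have h2 := ((((h (k+1)).const_mul (2 * a ^ 2)).sub (h (k+3))).abs.const_mul (2 * π)⁻¹)
    refine h2.mono (by rw [hf]; fun_prop) (Filter.Eventually.of_forall fun r => ?_)
    apply le_of_eq
    simp only [hf, Pi.sub_apply, norm_mul, norm_eq_abs, abs_abs, abs_exp]
    rw [show 2 * a ^ 2 * (r ^ (k + 1) * rexp (-(1 / 2) * r ^ 2)) - r ^ (k + 3) * rexp (-(1 / 2) * r ^ 2)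
      = r * r ^ k * rexp (-(1 / 2) * r ^ 2) * (2 * a ^ 2 - r ^ 2) by ring]
    simp only [abs_mul, abs_exp]
    ring)
  have hl : ∀ p : ℝ × ℝ, p.1 • ((2 * π)⁻¹ *
      rexp (-(1 / 2) * ((polarCoord.symm p).1 ^ 2 + (polarCoord.symm p).2 ^ 2)) *
      (|2 * a ^ 2 - (polarCoord.symm p).1 ^ 2 - (polarCoord.symm p).2 ^ 2| *
        ((c * a - s * (polarCoord.symm p).1) ^ 4 - 6 * (c * a - s * (polarCoord.symm p).1) ^ 2 + 3)))
      = f p.1 * (D 0 + D 1 * (p.1 * cos p.2) + D 2 * (p.1 * cos p.2) ^ 2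
      + D 3 * (p.1 * cos p.2) ^ 3 + D 4 * (p.1 * cos p.2) ^ 4) := by
    intro p
    simp only [polarCoord_symm_apply, smul_eq_mul, hf, hD]
    have h1 : (p.1 * cos p.2) ^ 2 + (p.1 * sin p.2) ^ 2 = p.1 ^ 2 := by
      rw [mul_pow, mul_pow, ← mul_add, cos_sq_add_sin_sq, mul_one]
    rw [sub_sub, h1]
    generalize p.1 * cos p.2 = x
    have : (c * a - s * x) ^ 4 - 6 * (c * a - s * x) ^ 2 + 3 =
        c ^ 4 * a ^ 4 - 6 * c ^ 2 * a ^ 2 + 3 +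
        (-4 * c ^ 3 * s * a ^ 3 + 12 * c * s * a) * x + (6 * c ^ 2 * s ^ 2 * a ^ 2 - 6 * s ^ 2) * x ^ 2
        + (-4 * c * s ^ 3 * a) * x ^ 3 + s ^ 4 * x ^ 4 := by ring
    rw [this, hc4, hs4, hc, hs]
    ring
  simp_rw [hl]
  rw [key]
  refine integral_congr_ae (Filter.Eventually.of_forall fun r => ?_)
  simp only [hf, hD]
  have := pi_ne_zero
  field_simp
  ring

lemma aux_outer :
    ∫ a : ℝ, (2 * a ^ 2 * ((a ^ 4 / 9 - 2 * a ^ 2 + 3) + 2 * (2 / 3 * a ^ 2 - 2) + 8 * (1 / 6))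
      - (2 * (a ^ 4 / 9 - 2 * a ^ 2 + 3) + 8 * (2 / 3 * a ^ 2 - 2) + 48 * (1 / 6))
      + 2 * exp (-a ^ 2) * (2 * (a ^ 4 / 9 - 2 * a ^ 2 + 3)
        + (2 / 3 * a ^ 2 - 2) * (8 + 4 * a ^ 2) + (1 / 6) * (48 + 32 * a ^ 2 + 8 * a ^ 4)))
      ∂(gaussianReal 0 1) = -(56 / (27 * √3)) := by
  rw [integral_gaussianReal_eq_integral_smul one_ne_zero]
  have h (n : ℕ) := aux_integrable n (b := 1/2) (by norm_num)
  have g (n : ℕ) := aux_integrable n (b := 3/2) (by norm_num)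
  have e : ∀ a : ℝ, gaussianPDFReal 0 1 a • (2 * a ^ 2 * ((a ^ 4 / 9 - 2 * a ^ 2 + 3) + 2 * (2 / 3 * a ^ 2 - 2) + 8 * (1 / 6))
      - (2 * (a ^ 4 / 9 - 2 * a ^ 2 + 3) + 8 * (2 / 3 * a ^ 2 - 2) + 48 * (1 / 6))
      + 2 * exp (-a ^ 2) * (2 * (a ^ 4 / 9 - 2 * a ^ 2 + 3)
        + (2 / 3 * a ^ 2 - 2) * (8 + 4 * a ^ 2) + (1 / 6) * (48 + 32 * a ^ 2 + 8 * a ^ 4))) =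
      (√(2 * π))⁻¹ * ((2 / 9 * (a ^ 6 * exp (-(1/2) * a ^ 2)) + (-14 / 9) * (a ^ 4 * exp (-(1/2) * a ^ 2))
        + (-2 / 3) * (a ^ 2 * exp (-(1/2) * a ^ 2)) + 2 * (a ^ 0 * exp (-(1/2) * a ^ 2)))
        + ((76 / 9) * (a ^ 4 * exp (-(3/2) * a ^ 2))
        + (-8 / 3) * (a ^ 2 * exp (-(3/2) * a ^ 2)) + (-4) * (a ^ 0 * exp (-(3/2) * a ^ 2)))) := by
    intro a
    have e1 : exp (-(3/2) * a ^ 2) = exp (-(1/2) * a ^ 2) * exp (-a ^ 2) := by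
      rw [← exp_add]; ring_nf
    have e2 : gaussianPDFReal 0 1 a = (√(2 * π))⁻¹ * exp (-(1/2) * a ^ 2) := by
      simp only [gaussianPDFReal, NNReal.coe_one, mul_one, sub_zero]
      ring_nf
    rw [e1, e2, smul_eq_mul]
    ring
  simp_rw [e]
  rw [integral_const_mul, integral_add
    (((((h 6).const_mul _).fun_add ((h 4).const_mul _)).fun_add ((h 2).const_mul _)).fun_add ((h 0).const_mul _))
    ((((g 4).const_mul _).fun_add ((g 2).const_mul _)).fun_add ((g 0).const_mul _)),
    integral_add ((((h 6).const_mul _).fun_add ((h 4).const_mul _)).fun_add ((h 2).const_mul _)) ((h 0).const_mul _),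
    integral_add (((h 6).const_mul _).fun_add ((h 4).const_mul _)) ((h 2).const_mul _),
    integral_add ((h 6).const_mul _) ((h 4).const_mul _),
    integral_add (((g 4).const_mul _).fun_add ((g 2).const_mul _)) ((g 0).const_mul _),
    integral_add ((g 4).const_mul _) ((g 2).const_mul _)]
  simp only [integral_const_mul]
  rw [aux_rec 4 (by norm_num : (0:ℝ) < 1/2), aux_rec 2 (by norm_num : (0:ℝ) < 1/2),
    aux_rec 0 (by norm_num : (0:ℝ) < 1/2), aux_rec 2 (by norm_num : (0:ℝ) < 3/2),
    aux_rec 0 (by norm_num : (0:ℝ) < 3/2), aux_zero, aux_zero]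
  have h3 : √(π / (3/2)) = √(2 * π) / √3 := by
    rw [← sqrt_div (by positivity)]; congr 1; ring
  rw [h3]
  have : √(2 * π) ≠ 0 := by positivity
  have : √3 ≠ 0 := by positivity
  field_simp
  norm_num

def AllLp {Ω : Type*} [MeasurableSpace Ω] (μ : Measure Ω) (f : Ω → ℝ) : Prop :=
  ∀ p : NNReal, MemLp f p μ

lemma AllLp.add {Ω : Type*} [MeasurableSpace Ω] {μ : Measure Ω} {f g : Ω → ℝ}
    (hf : AllLp μ f) (hg : AllLp μ g) : AllLp μ (fun x => f x + g x) := fun p => (hf p).add (hg p)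

lemma AllLp.sub {Ω : Type*} [MeasurableSpace Ω] {μ : Measure Ω} {f g : Ω → ℝ}
    (hf : AllLp μ f) (hg : AllLp μ g) : AllLp μ (fun x => f x - g x) := fun p => (hf p).sub (hg p)

lemma AllLp.abs {Ω : Type*} [MeasurableSpace Ω] {μ : Measure Ω} {f : Ω → ℝ}
    (hf : AllLp μ f) : AllLp μ (fun x => |f x|) := fun p => (hf p).abs

lemma AllLp.const {Ω : Type*} [MeasurableSpace Ω] {μ : Measure Ω} [IsFiniteMeasure μ] (c : ℝ) :
    AllLp μ (fun _ => c) := fun _ => memLp_const c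

lemma AllLp.mul {Ω : Type*} [MeasurableSpace Ω] {μ : Measure Ω} {f g : Ω → ℝ}
    (hf : AllLp μ f) (hg : AllLp μ g) : AllLp μ (fun x => f x * g x) := by
  intro p
  have : ENNReal.HolderTriple ((2 * p : NNReal) : ENNReal) ((2 * p : NNReal) : ENNReal) p := by
    constructor
    push_cast
    rw [← two_mul, ENNReal.mul_inv (by simp) (by simp), ← mul_assoc,
      ENNReal.mul_inv_cancel (by simp) (by simp), one_mul]
  exact MemLp.mul (hg (2 * p)) (hf (2 * p))

lemma AllLp.pow {Ω : Type*} [MeasurableSpace Ω] {μ : Measure Ω} [IsFiniteMeasure μ] {f : Ω → ℝ}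
    (hf : AllLp μ f) (n : ℕ) : AllLp μ (fun x => f x ^ n) := by
  induction n with
  | zero => simpa using AllLp.const (μ := μ) 1
  | succ n ih => simpa [pow_succ] using ih.mul hf

lemma aux_int3 (c s : ℝ) : Integrable (fun q : ℝ × ℝ × ℝ =>
      |2 * q.1 ^ 2 - q.2.1 ^ 2 - q.2.2 ^ 2| *
      ((c * q.1 - s * q.2.1) ^ 4 - 6 * (c * q.1 - s * q.2.1) ^ 2 + 3))
      ((gaussianReal 0 1).prod ((gaussianReal 0 1).prod (gaussianReal 0 1))) := by
  set μ := ((gaussianReal 0 1).prod ((gaussianReal 0 1).prod (gaussianReal 0 1)))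
  have h0 : AllLp μ (fun q => q.1) := fun p =>
    (memLp_id_gaussianReal (μ := 0) (v := 1) p).comp_measurePreserving measurePreserving_fst
  have h1 : AllLp μ (fun q => q.2.1) := fun p =>
    ((memLp_id_gaussianReal (μ := 0) (v := 1) p).comp_measurePreserving
      measurePreserving_fst).comp_measurePreserving measurePreserving_snd
  have h2 : AllLp μ (fun q => q.2.2) := fun p =>
    ((memLp_id_gaussianReal (μ := 0) (v := 1) p).comp_measurePreserving
      measurePreserving_snd).comp_measurePreserving measurePreserving_snd
  have hw := ((AllLp.const c).mul h0).sub ((AllLp.const s).mul h1)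
  have := ((((AllLp.const 2).mul (h0.pow 2)).sub (h1.pow 2)).sub (h2.pow 2)).abs.mul
    (((hw.pow 4).sub ((AllLp.const 6).mul (hw.pow 2))).add (AllLp.const 3))
  exact memLp_one_iff_integrable.1 (this 1)

lemma aux_pi3 : MeasurePreserving (fun y : Fin 3 → ℝ => (y 0, y 1, y 2))
    (Measure.pi fun _ => gaussianReal 0 1)
    ((gaussianReal 0 1).prod ((gaussianReal 0 1).prod (gaussianReal 0 1))) := by
  have h1 := measurePreserving_piFinSuccAbove (fun _ : Fin 3 => gaussianReal 0 1) 0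
  have h2 := measurePreserving_finTwoArrow (gaussianReal 0 1)
  exact ((MeasurePreserving.id (gaussianReal 0 1)).prod h2).comp h1

lemma aux_full (c s : ℝ) (hc : c ^ 2 = 1 / 3) (hs : s ^ 2 = 2 / 3) :
    ∫ y : Fin 3 → ℝ, |2 * y 0 ^ 2 - y 1 ^ 2 - y 2 ^ 2| *
      ((c * y 0 - s * y 1) ^ 4 - 6 * (c * y 0 - s * y 1) ^ 2 + 3)
      ∂(Measure.pi fun _ => gaussianReal 0 1) = -(56 / (27 * √3)) := by
  have hi := aux_int3 c s
  have h := integral_map (μ := Measure.pi fun _ : Fin 3 => gaussianReal 0 1)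
    aux_pi3.measurable.aemeasurable (aux_pi3.map_eq.symm ▸ hi.aestronglyMeasurable)
  rw [aux_pi3.map_eq] at h
  rw [← h, integral_prod _ hi]
  simp only [aux_inner _ c s hc hs]
  exact aux_outer

lemma aux_rot (f : (Fin 3 → ℝ) → ℝ) (hf : Continuous f) (c s : ℝ)
    (hc : c ^ 2 = 1 / 3) (hs : s ^ 2 = 2 / 3) :
    ∫ y, f y ∂(Measure.pi fun _ : Fin 3 => gaussianReal 0 1) =
    ∫ y : Fin 3 → ℝ, f ![s * y 0 + c * y 1, y 2, c * y 0 - s * y 1]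
      ∂(Measure.pi fun _ : Fin 3 => gaussianReal 0 1) := by
  set v : Fin 3 → EuclideanSpace ℝ (Fin 3) := ![!₂[s, 0, c], !₂[c, 0, -s], !₂[0, 1, 0]] with hv
  have ho : Orthonormal ℝ v := by
    rw [orthonormal_iff_ite]
    intro i j
    have hin : ∀ x y : EuclideanSpace ℝ (Fin 3),
        inner ℝ x y = x 0 * y 0 + x 1 * y 1 + x 2 * y 2 := by
      intro x y
      simp [PiLp.inner_apply, Fin.sum_univ_three]
      ring
    rw [hin]
    fin_cases i <;> fin_cases j <;> simp [hv] <;> nlinarith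
  obtain ⟨b, hb⟩ := Orthonormal.exists_orthonormalBasis_extension_of_card_eq (𝕜 := ℝ)
    (E := EuclideanSpace ℝ (Fin 3)) (ι := Fin 3) (by simp) (v := v) (s := Set.univ)
    (ho.comp _ Subtype.val_injective)
  have hm := stdGaussian_eq_map_pi_orthonormalBasis b
  rw [← map_pi_eq_stdGaussian] at hm
  have h1 := integral_map (μ := Measure.pi fun _ : Fin 3 => gaussianReal 0 1)
    (φ := WithLp.toLp 2) (f := fun x : EuclideanSpace ℝ (Fin 3) => f (WithLp.ofLp x))
    (by fun_prop) (by fun_prop)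
  have h2 := integral_map (μ := Measure.pi fun _ : Fin 3 => gaussianReal 0 1)
    (φ := (fun x : Fin 3 → ℝ ↦ ∑ i, x i • b i))
    (f := fun x : EuclideanSpace ℝ (Fin 3) => f (WithLp.ofLp x))
    (by fun_prop : Continuous _).measurable.aemeasurable (by fun_prop)
  rw [← hm, h1] at h2
  simp only at h2
  rw [h2]
  refine integral_congr_ae (Filter.Eventually.of_forall fun y => ?_)
  simp only
  congr 1
  ext i
  fin_cases i <;> simp [Fin.sum_univ_three, hb, hv] <;> ring

lemma aux_hermite (x : ℝ) : hermiteEval 4 x = x ^ 4 - 6 * x ^ 2 + 3 := by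
  simp only [hermiteEval, Polynomial.hermite_succ, Polynomial.hermite_zero]
  simp
  ring

lemma aux_main :
    (∫ y, |(1 / (2 * Real.sqrt 2)) * (y 0 * y 2) + (1 / 8) * (y 0) ^ 2 - (1 / 8) * (y 1) ^ 2|
        * hermiteEval 4 (y 2) ∂gauss3) = -(7 / (27 * Real.sqrt 3)) := by
  simp only [aux_hermite, gauss3]
  have h3 : (√3) ^ 2 = 3 := sq_sqrt (by norm_num)
  have h2 : (√2) ^ 2 = 2 := sq_sqrt (by norm_num)
  have hc : (1 / √3) ^ 2 = 1 / 3 := by rw [div_pow, h3]; norm_num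
  have hs : (√2 * (1 / √3)) ^ 2 = 2 / 3 := by rw [mul_pow, hc, h2]; norm_num
  rw [aux_rot _ (by fun_prop) (1 / √3) (√2 * (1 / √3)) hc hs]
  have e : ∀ y : Fin 3 → ℝ, ∀ c : ℝ, c ^ 2 = 1 / 3 →
    1 / (2 * √2) * ((√2 * c * y 0 + c * y 1) * (c * y 0 - √2 * c * y 1)) +
      1 / 8 * (√2 * c * y 0 + c * y 1) ^ 2 - 1 / 8 * y 2 ^ 2 =
      (1 / 8) * (2 * y 0 ^ 2 - y 1 ^ 2 - y 2 ^ 2) := by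
    intro y c hc
    have hh : 1 / (2 * √2) = √2 / 4 := by
      have : √2 ≠ 0 := by positivity
      field_simp
      linarith
    rw [hh]
    have : √2 / 4 * ((√2 * c * y 0 + c * y 1) * (c * y 0 - √2 * c * y 1)) +
      1 / 8 * (√2 * c * y 0 + c * y 1) ^ 2 - 1 / 8 * y 2 ^ 2 =
      c ^ 2 * (((√2) ^ 2 * y 0 ^ 2 - (√2) ^ 2 * √2 * y 0 * y 1 + √2 * y 0 * y 1 - √2 ^ 2 * y 1 ^ 2) / 4
       + (√2 ^ 2 * y 0 ^ 2 + 2 * √2 * y 0 * y 1 + y 1 ^ 2) / 8) - 1 / 8 * y 2 ^ 2 := by ring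
    rw [this, h2, hc]
    ring
  have key := aux_full _ _ hc hs
  have : ∀ y : Fin 3 → ℝ, |1 / (2 * √2) * (![√2 * (1 / √3) * y 0 + 1 / √3 * y 1, y 2, 1 / √3 * y 0 - √2 * (1 / √3) * y 1] 0 *
        ![√2 * (1 / √3) * y 0 + 1 / √3 * y 1, y 2, 1 / √3 * y 0 - √2 * (1 / √3) * y 1] 2) +
        1 / 8 * ![√2 * (1 / √3) * y 0 + 1 / √3 * y 1, y 2, 1 / √3 * y 0 - √2 * (1 / √3) * y 1] 0 ^ 2 -
        1 / 8 * ![√2 * (1 / √3) * y 0 + 1 / √3 * y 1, y 2, 1 / √3 * y 0 - √2 * (1 / √3) * y 1] 1 ^ 2| *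
      (![√2 * (1 / √3) * y 0 + 1 / √3 * y 1, y 2, 1 / √3 * y 0 - √2 * (1 / √3) * y 1] 2 ^ 4 -
        6 * ![√2 * (1 / √3) * y 0 + 1 / √3 * y 1, y 2, 1 / √3 * y 0 - √2 * (1 / √3) * y 1] 2 ^ 2 + 3) =
      (1 / 8) * (|2 * y 0 ^ 2 - y 1 ^ 2 - y 2 ^ 2| *
      ((1 / √3 * y 0 - √2 * (1 / √3) * y 1) ^ 4 - 6 * (1 / √3 * y 0 - √2 * (1 / √3) * y 1) ^ 2 + 3)) := by
    intro y
    simp only [Matrix.cons_val]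
    rw [e y _ hc, abs_mul, abs_of_nonneg (by norm_num : (0:ℝ) ≤ 1 / 8)]
    ring
  simp only [this]
  rw [integral_const_mul, key]
  ring

/-- With `Y₃ = y 0`, `Y₄ = y 1`, `Y₅ = y 2` independent standard Gaussians,
`E[ |(1/(2√2))·Y₃Y₅ + (1/8)·Y₃² − (1/8)·Y₄²| · H₄(Y₅) ] = −7/(27√3)`, and consequently
`k₅ = (1/π)·E[...] = −7/(27√3·π)`. -/
theorem expectation_abs_quadratic_mul_H4 :
    (∫ y, |(1 / (2 * Real.sqrt 2)) * (y 0 * y 2) + (1 / 8) * (y 0) ^ 2 - (1 / 8) * (y 1) ^ 2|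
        * hermiteEval 4 (y 2) ∂gauss3) = -(7 / (27 * Real.sqrt 3)) ∧
    (1 / π) *
      (∫ y, |(1 / (2 * Real.sqrt 2)) * (y 0 * y 2) + (1 / 8) * (y 0) ^ 2 - (1 / 8) * (y 1) ^ 2|
        * hermiteEval 4 (y 2) ∂gauss3) = -(7 / (27 * Real.sqrt 3 * π)) := by
  have h := aux_main
  refine ⟨h, ?_⟩
  rw [h]
  have := pi_ne_zero
  field_simp
end
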